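/- The trace-dual lattice of B in M_e(K) equals B* = b*·ι(B) = ι(B)·b*; that is, the set {b ∈ M_e(K) : tr(b·ι(c)) ∈ R for all c ∈ B} equals b*·ι(B), which also equals ι(B)·b*, and consists exactly of those matrices b ∈ M_e(K) with b_{ij} ∈ R for i ≥ j and b_{ij} ∈ u^{-1}R for i < j. -/

import Mathlib

/-!
STATEMENT 2: The trace-dual lattice of `B` in `M_e(K)` equals `B* = b*·ι(B) = ι(B)·b*`,
and consists exactly of the matrices with entries in `R` on and below the diagonal and in
`u⁻¹R` above the diagonal.  Here `R = ℂ[[u,v]]`, `K = Frac R`, and `B ⊆ M_e(R)` is the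
subalgebra of matrices whose entries below the diagonal lie in `uR`.
-/

noncomputable section

/-- `R = ℂ[[u,v]]`, the ring of formal power series in two variables over `ℂ`. -/
abbrev R : Type := MvPowerSeries (Fin 2) ℂ

instance : IsDomain R := NoZeroDivisors.to_isDomain _

/-- `K`, the field of fractions of `R`. -/
abbrev K : Type := FractionRing R

/-- The variable `u ∈ R`. -/
abbrev u : R := MvPowerSeries.X 0

/-- The variable `v ∈ R`. -/
abbrev v : R := MvPowerSeries.X 1

/-- The set `B ⊆ M_e(R)` of matrices whose entries strictly below the diagonal lie in `uR`. -/
def Bset (e : ℕ) : Set (Matrix (Fin e) (Fin e) R) :=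
  {g | ∀ i j : Fin e, j < i → g i j ∈ Ideal.span {u}}

/-- The matrix `b* ∈ M_e(K)`, with `u⁻¹` on the first superdiagonal, `1` in the lower left
corner, and `0` elsewhere. -/
def bstar (e : ℕ) : Matrix (Fin e) (Fin e) K :=
  Matrix.of fun i j =>
    if (i : ℕ) + 1 = (j : ℕ) then (algebraMap R K u)⁻¹
    else if (i : ℕ) = e - 1 ∧ (j : ℕ) = 0 then 1 else 0

/-- The entrywise inclusion `ι : M_e(R) → M_e(K)`. -/
def ι (e : ℕ) (g : Matrix (Fin e) (Fin e) R) : Matrix (Fin e) (Fin e) K :=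
  g.map (algebraMap R K)

theorem algebraMap_u_ne_zero : algebraMap R K u ≠ 0 := by
  rw [Ne, IsFractionRing.to_map_eq_zero_iff]
  intro h
  have h₁ := MvPowerSeries.coeff_index_single_self_X (R := ℂ) (0 : Fin 2)
  rw [show (MvPowerSeries.X 0 : R) = 0 from h, map_zero] at h₁
  exact zero_ne_one h₁

theorem bstar_mul_apply_castSucc {n : ℕ} (M : Matrix (Fin (n + 1)) (Fin (n + 1)) K)
    (i : Fin n) (j : Fin (n + 1)) :
    (bstar (n + 1) * M) i.castSucc j = (algebraMap R K u)⁻¹ * M i.succ j := by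
  rw [Matrix.mul_apply, Finset.sum_eq_single i.succ]
  · simp [bstar]
  · intro k _ hk
    have h₁ : ¬ (i : ℕ) + 1 = k := fun h => hk (Fin.ext (by simp [h]))
    have h₂ : ¬ (i : ℕ) = n := i.isLt.ne
    simp [bstar, h₁, h₂]
  · simp

theorem bstar_mul_apply_last {n : ℕ} (M : Matrix (Fin (n + 1)) (Fin (n + 1)) K)
    (j : Fin (n + 1)) : (bstar (n + 1) * M) (Fin.last n) j = M 0 j := by
  rw [Matrix.mul_apply, Finset.sum_eq_single 0]
  · simp [bstar]
  · intro k _ hk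
    have h₁ : ¬ n + 1 = (k : ℕ) := k.isLt.ne'
    simp [bstar, h₁, hk]
  · simp

theorem mul_bstar_apply_succ {n : ℕ} (M : Matrix (Fin (n + 1)) (Fin (n + 1)) K)
    (i : Fin (n + 1)) (j : Fin n) :
    (M * bstar (n + 1)) i j.succ = (algebraMap R K u)⁻¹ * M i j.castSucc := by
  rw [Matrix.mul_apply, Finset.sum_eq_single j.castSucc]
  · simp [bstar, mul_comm]
  · intro k _ hk
    have h₁ : ¬ (k : ℕ) = j := fun h => hk (Fin.ext (by simp [h]))
    simp [bstar, h₁]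
  · simp

theorem mul_bstar_apply_zero {n : ℕ} (M : Matrix (Fin (n + 1)) (Fin (n + 1)) K)
    (i : Fin (n + 1)) : (M * bstar (n + 1)) i 0 = M i (Fin.last n) := by
  rw [Matrix.mul_apply, Finset.sum_eq_single (Fin.last n)]
  · simp [bstar]
  · intro k _ hk
    have h₁ : ¬ (k : ℕ) = n := fun h => hk (Fin.ext (by simp [h]))
    simp [bstar, h₁]
  · simp

/-- The matrices over `K` with entries in `R` on and below the diagonal and in `u⁻¹R` above it. -/
def dualLattice (e : ℕ) : Set (Matrix (Fin e) (Fin e) K) :=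
  {b | ∀ i j : Fin e,
    ((j : ℕ) ≤ (i : ℕ) → b i j ∈ Set.range (algebraMap R K)) ∧
    ((i : ℕ) < (j : ℕ) → ∃ r : R, b i j = (algebraMap R K u)⁻¹ * algebraMap R K r)}

theorem exists_coeff_of_mem_dualLattice {e : ℕ} {b : Matrix (Fin e) (Fin e) K}
    (hb : b ∈ dualLattice e) : ∃ r : Matrix (Fin e) (Fin e) R, ∀ i j,
      b i j = if (j : ℕ) ≤ i then algebraMap R K (r i j)
        else (algebraMap R K u)⁻¹ * algebraMap R K (r i j) := by
  have h : ∀ i j, ∃ r : R, b i j = if (j : ℕ) ≤ i then algebraMap R K r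
      else (algebraMap R K u)⁻¹ * algebraMap R K r := by
    intro i j
    by_cases hij : (j : ℕ) ≤ i
    · obtain ⟨r, hr⟩ := (hb i j).1 hij
      exact ⟨r, by rw [if_pos hij, hr]⟩
    · obtain ⟨r, hr⟩ := (hb i j).2 (not_le.mp hij)
      exact ⟨r, by rw [if_neg hij, hr]⟩
  choose r hr using h
  exact ⟨r, hr⟩

theorem exists_inv_mul_of_mem_span {r : R} (hr : r ∈ Ideal.span {u}) :
    (algebraMap R K u)⁻¹ * algebraMap R K r ∈ Set.range (algebraMap R K) := by
  obtain ⟨s, rfl⟩ := Ideal.mem_span_singleton.mp hr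
  exact ⟨s, by rw [map_mul, inv_mul_cancel_left₀ algebraMap_u_ne_zero]⟩

theorem bstar_mul_image_eq (n : ℕ) :
    (fun c => bstar (n + 1) * ι (n + 1) c) '' Bset (n + 1) = dualLattice (n + 1) := by
  ext b
  constructor
  · rintro ⟨c, hc, rfl⟩ i j
    induction i using Fin.lastCases with
    | last =>
      simp only [bstar_mul_apply_last]
      exact ⟨fun _ => ⟨_, rfl⟩, fun h => absurd h (not_lt.mpr (Fin.le_last j))⟩
    | cast i =>
      simp only [bstar_mul_apply_castSucc]
      refine ⟨fun h => exists_inv_mul_of_mem_span (hc _ _ ?_), fun _ => ⟨_, rfl⟩⟩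
      rw [Fin.lt_def, Fin.val_succ]
      exact Nat.lt_succ_of_le h
  · intro hb
    obtain ⟨r, hr⟩ := exists_coeff_of_mem_dualLattice hb
    refine ⟨Matrix.of fun i j => Fin.cases (r (Fin.last n) j)
      (fun k => if (j : ℕ) ≤ k then u * r k.castSucc j else r k.castSucc j) i, ?_, ?_⟩
    · intro i j hij
      induction i using Fin.cases with
      | zero => exact absurd hij (Fin.not_lt_zero j)
      | succ i =>
        have h : (j : ℕ) ≤ i := Nat.le_of_lt_succ hij
        simpa [h] using Ideal.mul_mem_right _ _ (Ideal.mem_span_singleton_self u)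
    · ext i j
      induction i using Fin.lastCases with
      | last =>
        simp only [bstar_mul_apply_last, hr]
        simp [ι, Fin.is_le]
      | cast i =>
        simp only [bstar_mul_apply_castSucc, hr]
        by_cases h : (j : ℕ) ≤ i
        · simp [ι, h, inv_mul_cancel_left₀ algebraMap_u_ne_zero]
        · simp [ι, h]

theorem mul_bstar_image_eq (n : ℕ) :
    (fun c => ι (n + 1) c * bstar (n + 1)) '' Bset (n + 1) = dualLattice (n + 1) := by
  ext b
  constructor
  · rintro ⟨c, hc, rfl⟩ i j
    induction j using Fin.cases with
    | zero =>
      simp only [mul_bstar_apply_zero]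
      exact ⟨fun _ => ⟨_, rfl⟩, fun h => absurd h (Nat.not_lt_zero _)⟩
    | succ j =>
      simp only [mul_bstar_apply_succ]
      exact ⟨fun h => exists_inv_mul_of_mem_span (hc _ _ h), fun _ => ⟨_, rfl⟩⟩
  · intro hb
    obtain ⟨r, hr⟩ := exists_coeff_of_mem_dualLattice hb
    refine ⟨Matrix.of fun i j => Fin.lastCases (r i 0)
      (fun k => if (k : ℕ) < i then u * r i k.succ else r i k.succ) j, ?_, ?_⟩
    · intro i j hij
      induction j using Fin.lastCases with
      | last => exact absurd hij (not_lt.mpr (Fin.le_last i))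
      | cast j =>
        have h : (j : ℕ) < i := hij
        simpa [h] using Ideal.mul_mem_right _ _ (Ideal.mem_span_singleton_self u)
    · ext i j
      induction j using Fin.cases with
      | zero =>
        simp only [mul_bstar_apply_zero, hr]
        simp [ι]
      | succ j =>
        simp only [mul_bstar_apply_succ, hr]
        by_cases h : (j : ℕ) < i
        · simp [ι, h, inv_mul_cancel_left₀ algebraMap_u_ne_zero]
        · simp [ι, h]

theorem trace_mul_ι_single {e : ℕ} (b : Matrix (Fin e) (Fin e) K) (i j : Fin e) (r : R) :
    Matrix.trace (b * ι e (Matrix.single j i r)) = b i j * algebraMap R K r := by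
  have h : ι e (Matrix.single j i r) = Matrix.single j i (algebraMap R K r) :=
    Matrix.map_single j i r (algebraMap R K)
  rw [h, Matrix.trace_mul_single]
  simp

theorem trace_dual_eq (e : ℕ) :
    {b : Matrix (Fin e) (Fin e) K |
      ∀ c ∈ Bset e, Matrix.trace (b * ι e c) ∈ Set.range (algebraMap R K)} = dualLattice e := by
  ext b
  constructor
  · intro hb i j
    constructor
    · intro hij
      have h := hb (Matrix.single j i 1) fun k l hlk => by
        rw [Matrix.single_apply_of_ne]
        · exact Ideal.zero_mem _
        · rintro ⟨rfl, rfl⟩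
          exact absurd hlk (not_lt.mpr hij)
      rwa [trace_mul_ι_single, map_one, mul_one] at h
    · intro _
      have h := hb (Matrix.single j i u) fun k l _ => by
        rw [Matrix.single_apply]
        split_ifs
        · exact Ideal.mem_span_singleton_self u
        · exact Ideal.zero_mem _
      rw [trace_mul_ι_single] at h
      obtain ⟨r, hr⟩ := h
      exact ⟨r, by rw [hr, mul_comm, mul_inv_cancel_right₀ algebraMap_u_ne_zero]⟩
  · intro hb c hc
    change _ ∈ (algebraMap R K).range
    refine Subring.sum_mem _ fun i _ => ?_
    rw [Matrix.diag_apply, Matrix.mul_apply]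
    refine Subring.sum_mem _ fun j _ => ?_
    by_cases hij : (j : ℕ) ≤ i
    · exact Subring.mul_mem _ ((hb i j).1 hij) ⟨c j i, rfl⟩
    · obtain ⟨r, hr⟩ := (hb i j).2 (not_le.mp hij)
      rw [hr, mul_right_comm]
      exact Subring.mul_mem _ (exists_inv_mul_of_mem_span (hc j i (not_le.mp hij))) ⟨r, rfl⟩

theorem trace_dual_of_B (e : ℕ) (he : 1 ≤ e) :
    {b : Matrix (Fin e) (Fin e) K |
        ∀ c ∈ Bset e, Matrix.trace (b * ι e c) ∈ Set.range (algebraMap R K)} =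
      (fun c => bstar e * ι e c) '' Bset e ∧
    (fun c => bstar e * ι e c) '' Bset e = (fun c => ι e c * bstar e) '' Bset e ∧
    (fun c => bstar e * ι e c) '' Bset e =
      {b : Matrix (Fin e) (Fin e) K | ∀ i j : Fin e,
        ((j : ℕ) ≤ (i : ℕ) → b i j ∈ Set.range (algebraMap R K)) ∧
        ((i : ℕ) < (j : ℕ) → ∃ r : R, b i j = (algebraMap R K u)⁻¹ * algebraMap R K r)} := by
  obtain ⟨n, rfl⟩ := Nat.exists_eq_add_of_le' he
  refine ⟨?_, ?_, bstar_mul_image_eq n⟩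
  · rw [trace_dual_eq, bstar_mul_image_eq]
  · rw [bstar_mul_image_eq, mul_bstar_image_eq]

end
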